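/- (Behavior of φ at infinity) Assume (W) in dimension N = 1 with g ≡ 1/π, and let φ be the solution of I1[φ] = W'(φ) on ℝ with φ(−∞) = 0, φ(+∞) = 1, φ(0) = 1/2 and φ' > 0. Then there exist constants K0, K1 > 0 such that: |φ(x) − H(x) + 1/(απx)| ≤ K1/x² for |x| ≥ 1, where H is the Heaviside function (H(x) = 1 for x ≥ 0, H(x) = 0 for x < 0); and for every x ∈ ℝ: 0 < K0/(1+x²) ≤ φ'(x) ≤ K1/(1+x²), −K1/(1+x²) ≤ φ''(x) ≤ K1/(1+x²), and −K1/(1+x²) ≤ φ'''(x) ≤ K1/(1+x²). -/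

import Mathlib

open MeasureTheory Set Filter Topology Metric

noncomputable section

/-- `I1^{1,r}[U,x]` in dimension one with `g ≡ 1/π` (half-Laplacian). -/
def J1 (r : ℝ) (U : ℝ → ℝ) (x : ℝ) : ℝ :=
  ∫ z in {z : ℝ | |z| ≤ r}, (U (x + z) - U x - deriv U x * z) / (Real.pi * z ^ 2)

/-- `I1^{2,r}[U,x]` in dimension one with `g ≡ 1/π`. -/
def J2 (r : ℝ) (U : ℝ → ℝ) (x : ℝ) : ℝ :=
  ∫ z in {z : ℝ | r < |z|}, (U (x + z) - U x) / (Real.pi * z ^ 2)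

/-- The one-dimensional operator `I1 = -(-Δ)^{1/2}`. -/
def halfLap (U : ℝ → ℝ) (x : ℝ) : ℝ := J1 1 U x + J2 1 U x

/-- Assumption (W): `W ∈ C^{4,β}`, 1-periodic, vanishing exactly on ℤ, with `W''(0) > 0`. -/
def AssumptionW (W : ℝ → ℝ) : Prop :=
  (∃ β ∈ Ioo (0:ℝ) 1, ContDiff ℝ 4 W ∧
    ∃ Kβ : ℝ, ∀ a b : ℝ, |iteratedDeriv 4 W a - iteratedDeriv 4 W b| ≤ Kβ * |a - b| ^ β) ∧
  (∀ v : ℝ, W (v + 1) = W v) ∧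
  (∀ k : ℤ, W (k : ℝ) = 0) ∧
  (∀ v : ℝ, (∀ k : ℤ, v ≠ (k : ℝ)) → 0 < W v) ∧
  0 < deriv (deriv W) 0

/-- The phase transition `φ`: solution of `I1[φ] = W'(φ)`, `φ(−∞)=0`, `φ(+∞)=1`,
`φ(0)=1/2`, `φ' > 0` (it is of class `C^{4,β}`, with bounded derivatives). -/
def IsPhi (W φ : ℝ → ℝ) : Prop :=
  ContDiff ℝ 4 φ ∧
  (∀ x : ℝ, halfLap φ x = deriv W (φ x)) ∧
  Tendsto φ atBot (𝓝 0) ∧ Tendsto φ atTop (𝓝 1) ∧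
  φ 0 = 1 / 2 ∧ (∀ x : ℝ, 0 < deriv φ x)

/-- The Heaviside function. -/
def Heaviside (x : ℝ) : ℝ := if 0 ≤ x then 1 else 0

/-- The symmetrised integral form of `halfLap`. -/
def symLap (U : ℝ → ℝ) (x : ℝ) : ℝ :=
  ∫ z in Ioi (0 : ℝ), (U (x + z) + U (x - z) - 2 * U x) / (Real.pi * z ^ 2)

/-- Bounded functions of class `C²`. -/
def BddC2 (U : ℝ → ℝ) : Prop := ContDiff ℝ 2 U ∧ ∃ M : ℝ, ∀ x, |U x| ≤ M

lemma abs_taylor_one_le {U : ℝ → ℝ} (hU : ContDiff ℝ 2 U) {x K y : ℝ}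
    (hK : ∀ t ∈ Icc (x - 1) (x + 1), |deriv (deriv U) t| ≤ K) (hy : |y - x| ≤ 1) :
    |U y - U x - deriv U x * (y - x)| ≤ K * (y - x) ^ 2 := by
  have hd : Differentiable ℝ U := hU.differentiable (by norm_num)
  have hU' : ContDiff ℝ 1 (deriv U) := (contDiff_succ_iff_deriv.1 hU).2.2
  have hd' : Differentiable ℝ (deriv U) := hU'.differentiable (by norm_num)
  have hK0 : 0 ≤ K := (abs_nonneg _).trans (hK x ⟨by linarith, by linarith⟩)
  have hsub : ∀ t, |t - x| ≤ 1 → |deriv U t - deriv U x| ≤ K * |t - x| := by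
    intro t ht
    rw [abs_le] at ht
    have := (convex_Icc (x - 1) (x + 1)).norm_image_sub_le_of_norm_deriv_le (f := deriv U)
      (C := K) (fun s _ => hd' s) (fun s hs => hK s hs) (x := x) (y := t)
      ⟨by linarith, by linarith⟩ ⟨by linarith, by linarith⟩
    simpa [Real.norm_eq_abs] using this
  have hder : ∀ t, HasDerivAt (fun t => U t - deriv U x * (t - x)) (deriv U t - deriv U x) t := by
    intro t
    have h1 := (hd t).hasDerivAt
    have h2 : HasDerivAt (fun t => deriv U x * (t - x)) (deriv U x * 1) t :=
      ((hasDerivAt_id t).sub_const x).const_mul _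
    exact (h1.sub h2).congr_deriv (by ring)
  have := (convex_closedBall x |y - x|).norm_image_sub_le_of_norm_hasDerivWithin_le
      (f := fun t => U t - deriv U x * (t - x)) (f' := fun t => deriv U t - deriv U x)
      (C := K * |y - x|) (fun s _ => (hder s).hasDerivWithinAt)
      (fun s hs => by
        rw [mem_closedBall, Real.dist_eq] at hs
        rw [Real.norm_eq_abs]
        exact (hsub s (hs.trans hy)).trans (by gcongr)) (x := x) (y := y)
      (by simp) (by simp [Real.dist_eq])
  simp only [Real.norm_eq_abs, sub_self, mul_zero, sub_zero] at this
  calc |U y - U x - deriv U x * (y - x)| = |U y - deriv U x * (y - x) - U x| := by ring_nf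
    _ ≤ K * |y - x| * |y - x| := this
    _ = K * (y - x) ^ 2 := by rw [mul_assoc, ← sq, sq_abs]

lemma exists_abs_deriv2_le {U : ℝ → ℝ} (hU : ContDiff ℝ 2 U) (x : ℝ) :
    ∃ K : ℝ, ∀ t ∈ Icc (x - 1) (x + 1), |deriv (deriv U) t| ≤ K := by
  have hU' : ContDiff ℝ 1 (deriv U) := (contDiff_succ_iff_deriv.1 hU).2.2
  have hc : Continuous (deriv (deriv U)) := hU'.continuous_deriv le_rfl
  exact isCompact_Icc.exists_bound_of_continuousOn hc.continuousOn

lemma abs_secondDiff_div_le {U : ℝ → ℝ} (hU : ContDiff ℝ 2 U) {x K M z : ℝ}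
    (hK : ∀ t ∈ Icc (x - 1) (x + 1), |deriv (deriv U) t| ≤ K) (hM : ∀ t, |U t| ≤ M)
    (hz : 0 < z) :
    |(U (x + z) + U (x - z) - 2 * U x) / (Real.pi * z ^ 2)| ≤
      (4 * K + 8 * M) * (1 + z ^ 2)⁻¹ := by
  have hK0 : 0 ≤ K := (abs_nonneg _).trans (hK x ⟨by linarith, by linarith⟩)
  have hM0 : 0 ≤ M := (abs_nonneg _).trans (hM x)
  have hpi : (1 : ℝ) ≤ Real.pi := by linarith [Real.pi_gt_three]
  have hz2 : 0 < z ^ 2 := by positivity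
  rw [abs_div, abs_of_pos (by positivity : 0 < Real.pi * z ^ 2), ← div_eq_mul_inv,
    div_le_div_iff₀ (by positivity) (by positivity)]
  rcases le_or_gt z 1 with h1 | h1
  · have e1 := abs_taylor_one_le hU hK (y := x + z) (by simp [abs_of_pos hz, h1])
    have e2 := abs_taylor_one_le hU hK (y := x - z) (by simp [abs_of_pos hz, h1])
    have e3 : |U (x + z) + U (x - z) - 2 * U x| ≤ 2 * K * z ^ 2 := by
      rw [abs_le] at *
      ring_nf at e1 e2 ⊢
      constructor <;> linarith
    have hz1 : z ^ 2 ≤ 1 := by nlinarith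
    calc |U (x + z) + U (x - z) - 2 * U x| * (1 + z ^ 2) ≤ 2 * K * z ^ 2 * 2 := by
          gcongr; linarith
      _ ≤ (4 * K + 8 * M) * (1 * z ^ 2) := by nlinarith [mul_nonneg hM0 hz2.le]
      _ ≤ _ := by gcongr
  · have e3 : |U (x + z) + U (x - z) - 2 * U x| ≤ 4 * M := by
      have a1 := abs_le.1 (hM (x + z))
      have a2 := abs_le.1 (hM (x - z))
      have a3 := abs_le.1 (hM x)
      rw [abs_le]
      constructor <;> linarith
    have hz1 : 1 ≤ z ^ 2 := by nlinarith
    calc |U (x + z) + U (x - z) - 2 * U x| * (1 + z ^ 2) ≤ 4 * M * (2 * z ^ 2) := by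
          gcongr; linarith
      _ ≤ (4 * K + 8 * M) * (1 * z ^ 2) := by nlinarith [mul_nonneg hK0 hz2.le]
      _ ≤ _ := by gcongr

lemma BddC2.integrableOn {U : ℝ → ℝ} (hU : BddC2 U) (x : ℝ) :
    IntegrableOn (fun z => (U (x + z) + U (x - z) - 2 * U x) / (Real.pi * z ^ 2))
      (Ioi (0 : ℝ)) := by
  obtain ⟨hU, M, hM⟩ := hU
  obtain ⟨K, hK⟩ := exists_abs_deriv2_le hU x
  have hc := hU.continuous
  have hm := hc.measurable
  refine Integrable.mono' ((integrable_inv_one_add_sq.const_mul (4 * K + 8 * M)).integrableOn)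
    (Measurable.div (by fun_prop) (by fun_prop)).aestronglyMeasurable ?_
  refine (ae_restrict_iff' measurableSet_Ioi).2 (ae_of_all _ fun z hz => ?_)
  exact abs_secondDiff_div_le hU hK hM hz

lemma BddC2.halfLap_eq {U : ℝ → ℝ} (hU : BddC2 U) (x : ℝ) : halfLap U x = symLap U x := by
  obtain ⟨hU, M, hM⟩ := hU
  obtain ⟨K, hK⟩ := exists_abs_deriv2_le hU x
  have hK0 : 0 ≤ K := (abs_nonneg _).trans (hK x ⟨by linarith, by linarith⟩)
  have hM0 : 0 ≤ M := (abs_nonneg _).trans (hM x)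
  have hpi : (1 : ℝ) ≤ Real.pi := by linarith [Real.pi_gt_three]
  have hc := hU.continuous
  have hm := hc.measurable
  set s : Set ℝ := {z : ℝ | |z| ≤ 1} with hs
  have hsm : MeasurableSet s := measurableSet_le (by fun_prop) (by fun_prop)
  have hsc : {z : ℝ | 1 < |z|} = sᶜ := by ext z; simp [hs]
  set f : ℝ → ℝ := fun z => (U (x + z) - U x - deriv U x * z) / (Real.pi * z ^ 2) with hf
  set g : ℝ → ℝ := fun z => (U (x + z) - U x) / (Real.pi * z ^ 2) with hg
  have hInt : Integrable (fun z : ℝ => (2 * K + 4 * M) * (1 + z ^ 2)⁻¹) :=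
    integrable_inv_one_add_sq.const_mul _
  have hfi : IntegrableOn f s := by
    refine Integrable.mono' hInt.integrableOn
      (Measurable.div (by fun_prop) (by fun_prop)).aestronglyMeasurable ?_
    refine (ae_restrict_iff' hsm).2 (ae_of_all _ fun z hz => ?_)
    rcases eq_or_ne z 0 with rfl | h0
    · simp [hf]; positivity
    have hz2 : 0 < z ^ 2 := by positivity
    have hz1 : z ^ 2 ≤ 1 := by
      have : |z| ^ 2 ≤ 1 := by
        have := abs_nonneg z
        have hz : |z| ≤ 1 := hz
        nlinarith
      rwa [sq_abs] at this
    have e1 := abs_taylor_one_le hU hK (y := x + z) (by simpa [hs] using hz)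
    simp only [add_sub_cancel_left] at e1
    rw [Real.norm_eq_abs, hf, abs_div, abs_of_pos (by positivity : 0 < Real.pi * z ^ 2),
      ← div_eq_mul_inv, div_le_div_iff₀ (by positivity) (by positivity)]
    calc _ ≤ K * z ^ 2 * 2 := by gcongr; linarith
      _ ≤ (2 * K + 4 * M) * (1 * z ^ 2) := by nlinarith [mul_nonneg hM0 hz2.le]
      _ ≤ _ := by gcongr
  have hgi : IntegrableOn g sᶜ := by
    refine Integrable.mono' hInt.integrableOn
      (Measurable.div (by fun_prop) (by fun_prop)).aestronglyMeasurable ?_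
    refine (ae_restrict_iff' hsm.compl).2 (ae_of_all _ fun z hz => ?_)
    have hz1 : 1 ≤ z ^ 2 := by
      have hz : 1 < |z| := by simpa [hs] using hz
      rw [← sq_abs]; nlinarith
    have hz2 : 0 < z ^ 2 := by linarith
    have e3 : |U (x + z) - U x| ≤ 2 * M := by
      have a1 := abs_le.1 (hM (x + z))
      have a3 := abs_le.1 (hM x)
      rw [abs_le]
      constructor <;> linarith
    rw [Real.norm_eq_abs, hg, abs_div, abs_of_pos (by positivity : 0 < Real.pi * z ^ 2),
      ← div_eq_mul_inv, div_le_div_iff₀ (by positivity) (by positivity)]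
    calc _ ≤ 2 * M * (2 * z ^ 2) := by gcongr; linarith
      _ ≤ (2 * K + 4 * M) * (1 * z ^ 2) := by nlinarith [mul_nonneg hK0 hz2.le]
      _ ≤ _ := by gcongr
  set F : ℝ → ℝ := s.indicator f + sᶜ.indicator g with hF
  have hFi1 : Integrable (s.indicator f) := (integrable_indicator_iff hsm).2 hfi
  have hFi2 : Integrable (sᶜ.indicator g) := (integrable_indicator_iff hsm.compl).2 hgi
  have hFi : Integrable F := hFi1.add hFi2
  have hhalf : halfLap U x = ∫ z, F z := by
    rw [halfLap, J1, J2, hsc, ← integral_indicator hsm, ← integral_indicator hsm.compl,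
      ← integral_add hFi1 hFi2]
    rfl
  rw [hhalf, ← intervalIntegral.integral_Iic_add_Ioi hFi.integrableOn hFi.integrableOn (b := 0)]
  have hneg := integral_comp_neg_Ioi (0 : ℝ) F
  rw [neg_zero] at hneg
  rw [← hneg, ← integral_add hFi.comp_neg.integrableOn hFi.integrableOn, symLap]
  refine setIntegral_congr_fun measurableSet_Ioi fun z _ => ?_
  by_cases h : |z| ≤ 1
  · have h1 : z ∈ s := h
    have h2 : -z ∈ s := by simpa [hs] using h
    simp only [hF, Pi.add_apply, indicator_of_mem h1, indicator_of_mem h2,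
      indicator_of_notMem (notMem_compl_iff.2 h1), indicator_of_notMem (notMem_compl_iff.2 h2), hf]
    ring_nf
  · have h1 : z ∉ s := h
    have h2 : -z ∉ s := by simpa [hs] using h
    simp only [hF, Pi.add_apply, indicator_of_notMem h1, indicator_of_notMem h2,
      indicator_of_mem (mem_compl h1), indicator_of_mem (mem_compl h2), hg]
    ring_nf

lemma BddC2.sub {U V : ℝ → ℝ} (hU : BddC2 U) (hV : BddC2 V) : BddC2 fun x => U x - V x := by
  obtain ⟨hU, M, hM⟩ := hU
  obtain ⟨hV, N, hN⟩ := hV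
  exact ⟨hU.sub hV, M + N, fun x => (abs_sub _ _).trans (add_le_add (hM x) (hN x))⟩

lemma BddC2.const_mul {U : ℝ → ℝ} (hU : BddC2 U) (c : ℝ) : BddC2 fun x => c * U x := by
  obtain ⟨hU, M, hM⟩ := hU
  exact ⟨contDiff_const.mul hU, |c| * M, fun x => by rw [abs_mul]; gcongr; exact hM x⟩

lemma BddC2.translate {U : ℝ → ℝ} (hU : BddC2 U) (h : ℝ) : BddC2 fun x => U (x + h) := by
  obtain ⟨hU, M, hM⟩ := hU
  exact ⟨hU.comp (contDiff_id.add contDiff_const), M, fun x => hM _⟩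

lemma symLap_sub {U V : ℝ → ℝ} (hU : BddC2 U) (hV : BddC2 V) (x : ℝ) :
    symLap (fun x => U x - V x) x = symLap U x - symLap V x := by
  rw [symLap, symLap, symLap, ← integral_sub (hU.integrableOn x) (hV.integrableOn x)]
  congr 1; ext z; ring

lemma symLap_const_mul (U : ℝ → ℝ) (c x : ℝ) :
    symLap (fun x => c * U x) x = c * symLap U x := by
  rw [symLap, symLap, ← integral_const_mul]
  congr 1; ext z; ring

lemma symLap_translate (U : ℝ → ℝ) (h x : ℝ) :
    symLap (fun x => U (x + h)) x = symLap U (x + h) := by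
  rw [symLap, symLap]
  congr 1; ext z; ring_nf

/-- Maximum principle for `symLap`. -/
lemma nonpos_of_symLap_pos {w : ℝ → ℝ} (hc : Continuous w)
    (hw : Tendsto w (cocompact ℝ) (𝓝 0)) (h : ∀ x, 0 < w x → 0 < symLap w x) (x : ℝ) :
    w x ≤ 0 := by
  by_contra! hx
  obtain ⟨y, hy⟩ := hc.exists_forall_ge' x ((hw.eventually_lt_const hx).mono fun _ h => h.le)
  have hpos : 0 < w y := hx.trans_le (hy x)
  refine (h y hpos).not_ge (setIntegral_nonpos measurableSet_Ioi fun z _ => ?_)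
  exact div_nonpos_of_nonpos_of_nonneg (by linarith [hy (y + z), hy (y - z)])
    (by have := Real.pi_pos; positivity)

/-- The Poisson kernel of the half-plane at height `a`. -/
def lorentz (a x : ℝ) : ℝ := a / (Real.pi * (a ^ 2 + x ^ 2))

/-- The primitive of `lorentz a` that vanishes at `-∞`. -/
def arctanStep (a x : ℝ) : ℝ := 1 / 2 + Real.arctan (x / a) / Real.pi

lemma lorentz_pos {a : ℝ} (ha : 0 < a) (x : ℝ) : 0 < lorentz a x := by
  have := Real.pi_pos
  unfold lorentz; positivity

lemma lorentz_le {a : ℝ} (ha : 0 < a) (x : ℝ) : lorentz a x ≤ 1 / (Real.pi * a) := by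
  have := Real.pi_pos
  unfold lorentz
  rw [div_le_div_iff₀ (by positivity) (by positivity)]
  nlinarith [mul_nonneg this.le (sq_nonneg x)]

lemma contDiff_lorentz {a : ℝ} (ha : 0 < a) {n : WithTop ℕ∞} : ContDiff ℝ n (lorentz a) := by
  have := Real.pi_pos
  exact contDiff_const.div (by fun_prop) fun x => by positivity

lemma contDiff_arctanStep {a : ℝ} {n : WithTop ℕ∞} : ContDiff ℝ n (arctanStep a) :=
  contDiff_const.add ((Real.contDiff_arctan.comp (contDiff_id.div_const a)).div_const _)

lemma hasDerivAt_arctan_div {a : ℝ} (ha : 0 < a) (x : ℝ) :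
    HasDerivAt (fun x => Real.arctan (x / a)) (a / (a ^ 2 + x ^ 2)) x := by
  refine ((hasDerivAt_id x).div_const a).arctan.congr_deriv ?_
  simp only [id]
  field_simp

lemma hasDerivAt_arctanStep {a : ℝ} (ha : 0 < a) (x : ℝ) :
    HasDerivAt (arctanStep a) (lorentz a x) x := by
  have := Real.pi_pos
  refine (((hasDerivAt_arctan_div ha x).div_const Real.pi).const_add (1 / 2)).congr_deriv ?_
  unfold lorentz
  field_simp

lemma abs_arctanStep_le {a : ℝ} (x : ℝ) : |arctanStep a x| ≤ 1 := by
  have hpi := Real.pi_pos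
  have h1 := (Real.arctan_lt_pi_div_two (x / a)).le
  have h2 := (Real.neg_pi_div_two_lt_arctan (x / a)).le
  have h3 : |Real.arctan (x / a) / Real.pi| ≤ 1 / 2 := by
    rw [abs_div, abs_of_pos hpi, div_le_iff₀ hpi, abs_le]
    constructor <;> linarith
  rw [abs_le] at *
  unfold arctanStep
  constructor <;> linarith

lemma bddC2_lorentz {a : ℝ} (ha : 0 < a) : BddC2 (lorentz a) :=
  ⟨contDiff_lorentz ha, 1 / (Real.pi * a), fun x => by
    rw [abs_of_pos (lorentz_pos ha x)]; exact lorentz_le ha x⟩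

lemma bddC2_arctanStep {a : ℝ} : BddC2 (arctanStep a) :=
  ⟨contDiff_arctanStep, 1, abs_arctanStep_le⟩

lemma tendsto_log_sub_log_atTop (a x : ℝ) :
    Tendsto (fun z : ℝ => Real.log (a ^ 2 + (x + z) ^ 2) - Real.log (a ^ 2 + (x - z) ^ 2))
      atTop (𝓝 0) := by
  set f : ℝ → ℝ := fun s => Real.log (a ^ 2 * s ^ 2 + (x * s + 1) ^ 2) -
    Real.log (a ^ 2 * s ^ 2 + (x * s - 1) ^ 2) with hf
  have hc : ContinuousAt f 0 := by
    refine ContinuousAt.sub (ContinuousAt.log (by fun_prop) (by simp))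
      (ContinuousAt.log (by fun_prop) (by simp))
  have hlim : Tendsto (fun z : ℝ => f z⁻¹) atTop (𝓝 0) := by
    have := hc.tendsto.comp tendsto_inv_atTop_zero
    simpa [hf, Function.comp_def] using this
  have hne : ∀ b : ℝ, ∀ᶠ s in 𝓝 (0 : ℝ), 0 < a ^ 2 * s ^ 2 + (x * s + b) ^ 2 ∨ b = 0 := by
    intro b
    by_cases hb : b = 0
    · simp [hb]
    have h1 : ContinuousAt (fun s : ℝ => a ^ 2 * s ^ 2 + (x * s + b) ^ 2) 0 := by fun_prop
    have h2 : (0 : ℝ) < a ^ 2 * 0 ^ 2 + (x * 0 + b) ^ 2 := by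
      have := sq_pos_of_ne_zero hb
      simpa using this
    exact (h1.eventually_const_lt h2).mono fun _ h => Or.inl h
  refine hlim.congr' ?_
  filter_upwards [eventually_gt_atTop 0, tendsto_inv_atTop_zero.eventually (hne 1),
    tendsto_inv_atTop_zero.eventually (hne (-1))] with z hz h1 h2
  replace h1 := h1.resolve_right one_ne_zero
  replace h2 := h2.resolve_right (by norm_num)
  have e1 : a ^ 2 + (x + z) ^ 2 = z ^ 2 * (a ^ 2 * z⁻¹ ^ 2 + (x * z⁻¹ + 1) ^ 2) := by
    field_simp
  have e2 : a ^ 2 + (x - z) ^ 2 = z ^ 2 * (a ^ 2 * z⁻¹ ^ 2 + (x * z⁻¹ - 1) ^ 2) := by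
    field_simp
  rw [e1, e2, Real.log_mul (by positivity) h1.ne',
    Real.log_mul (by positivity) (by rw [sub_eq_add_neg]; exact h2.ne')]
  simp [hf]

lemma symLap_arctanStep {a : ℝ} (ha : 0 < a) (x : ℝ) :
    symLap (arctanStep a) x = -(x / (Real.pi * (a ^ 2 + x ^ 2))) := by
  have hpi := Real.pi_pos
  have hq : 0 < a ^ 2 + x ^ 2 := by positivity
  set N : ℝ → ℝ := fun z => arctanStep a (x + z) + arctanStep a (x - z) - 2 * arctanStep a x
    with hN
  set B : ℝ → ℝ := fun z => a / (Real.pi * (2 * (a ^ 2 + x ^ 2))) *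
    (-(2 * x / a) * (Real.arctan ((x + z) / a) - Real.arctan ((x - z) / a)) -
      (Real.log (a ^ 2 + (x + z) ^ 2) - Real.log (a ^ 2 + (x - z) ^ 2))) with hB
  set F : ℝ → ℝ := fun z => Real.pi⁻¹ * (B z - N z / z) with hF
  have hplus : ∀ z : ℝ, HasDerivAt (fun z => x + z) 1 z := fun z =>
    (hasDerivAt_id z).const_add x
  have hminus : ∀ z : ℝ, HasDerivAt (fun z => x - z) (-1) z := fun z =>
    (hasDerivAt_id z).const_sub x
  have hNd : ∀ z, HasDerivAt N (lorentz a (x + z) - lorentz a (x - z)) z := by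
    intro z
    have h1 := (hasDerivAt_arctanStep ha (x + z)).comp z (hplus z)
    have h2 := (hasDerivAt_arctanStep ha (x - z)).comp z (hminus z)
    exact ((h1.add h2).sub_const _).congr_deriv (by ring)
  have hBd : ∀ z, HasDerivAt B (-(4 * a * x) / (Real.pi * ((a ^ 2 + (x + z) ^ 2) *
      (a ^ 2 + (x - z) ^ 2)))) z := by
    intro z
    have p1 : 0 < a ^ 2 + (x + z) ^ 2 := by positivity
    have p2 : 0 < a ^ 2 + (x - z) ^ 2 := by positivity
    have h1 := (hasDerivAt_arctan_div ha (x + z)).comp z (hplus z)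
    have h2 := (hasDerivAt_arctan_div ha (x - z)).comp z (hminus z)
    have h3 := (((hplus z).pow 2).const_add (a ^ 2)).log p1.ne'
    have h4 := (((hminus z).pow 2).const_add (a ^ 2)).log p2.ne'
    refine ((((h1.sub h2).const_mul (-(2 * x / a))).sub (h3.sub h4)).const_mul
      (a / (Real.pi * (2 * (a ^ 2 + x ^ 2))))).congr_deriv ?_
    simp only [Pi.pow_apply]
    field_simp
    ring
  have hN0 : N 0 = 0 := by simp only [hN, add_zero, sub_zero]; ring
  have hB0 : B 0 = 0 := by simp [hB]
  have hF0 : F 0 = 0 := by simp [hF, hB0]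
  have hcont : ContinuousWithinAt F (Ici 0) 0 := by
    have h1 : (fun z => N z / z) = dslope N 0 := by
      ext z
      rcases eq_or_ne z 0 with rfl | hz
      · rw [dslope_same, (hNd 0).deriv]; simp
      · rw [dslope_of_ne _ hz, slope_def_field, hN0]; simp
    have h2 : ContinuousAt (fun z => N z / z) 0 := by
      rw [h1, continuousAt_dslope_same]
      exact (hNd 0).differentiableAt
    exact (continuousAt_const.mul ((hBd 0).continuousAt.sub h2)).continuousWithinAt
  have hder : ∀ z ∈ Ioi (0 : ℝ), HasDerivAt F (N z / (Real.pi * z ^ 2)) z := by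
    intro z hz
    have hz0 : (0 : ℝ) < z := hz
    have p1 : 0 < a ^ 2 + (x + z) ^ 2 := by positivity
    have p2 : 0 < a ^ 2 + (x - z) ^ 2 := by positivity
    refine (((hBd z).sub ((hNd z).div (hasDerivAt_id z) hz0.ne')).const_mul
      Real.pi⁻¹).congr_deriv ?_
    simp only [lorentz, id]
    field_simp
    ring
  have hlimN : Tendsto (fun z => N z / z) atTop (𝓝 0) := by
    refine squeeze_zero_norm' (a := fun z : ℝ => 4 * z⁻¹) ?_ ?_
    · filter_upwards [eventually_gt_atTop 0] with z hz
      rw [Real.norm_eq_abs, abs_div, abs_of_pos hz, div_eq_mul_inv]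
      gcongr
      have a1 := abs_le.1 (abs_arctanStep_le (a := a) (x + z))
      have a2 := abs_le.1 (abs_arctanStep_le (a := a) (x - z))
      have a3 := abs_le.1 (abs_arctanStep_le (a := a) x)
      rw [abs_le]
      constructor <;> simp only [hN] <;> linarith
    · simpa using tendsto_inv_atTop_zero.const_mul (4 : ℝ)
  have hat1 : Tendsto (fun z : ℝ => Real.arctan ((x + z) / a)) atTop (𝓝 (Real.pi / 2)) :=
    (tendsto_nhds_of_tendsto_nhdsWithin Real.tendsto_arctan_atTop).comp
      ((tendsto_atTop_add_const_left _ x tendsto_id).atTop_div_const ha)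
  have hat2 : Tendsto (fun z : ℝ => Real.arctan ((x - z) / a)) atTop (𝓝 (-(Real.pi / 2))) := by
    refine (tendsto_nhds_of_tendsto_nhdsWithin Real.tendsto_arctan_atBot).comp
      (Tendsto.atBot_div_const ha ?_)
    exact (tendsto_atBot_add_const_left _ x tendsto_neg_atTop_atBot).congr fun z =>
      (sub_eq_add_neg x z).symm
  have hlimB := (((hat1.sub hat2).const_mul (-(2 * x / a))).sub
    (tendsto_log_sub_log_atTop a x)).const_mul (a / (Real.pi * (2 * (a ^ 2 + x ^ 2))))
  have hlim := (hlimB.sub hlimN).const_mul Real.pi⁻¹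
  have := integral_Ioi_of_hasDerivAt_of_tendsto hcont hder
    ((bddC2_arctanStep (a := a)).integrableOn x) hlim
  rw [symLap, this, hF0]
  field_simp
  ring

/-- Forward difference quotient of step `h`. -/
def diffQuot (h : ℝ) (u : ℝ → ℝ) (x : ℝ) : ℝ := h⁻¹ * (u (x + h) - u x)

lemma BddC2.diffQuot {u : ℝ → ℝ} (hu : BddC2 u) (h : ℝ) : BddC2 (diffQuot h u) :=
  ((hu.translate h).sub hu).const_mul h⁻¹

lemma symLap_diffQuot {u : ℝ → ℝ} (hu : BddC2 u) (h x : ℝ) :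
    symLap (diffQuot h u) x = diffQuot h (symLap u) x := by
  have := symLap_const_mul (fun x => u (x + h) - u x) h⁻¹ x
  rw [symLap_sub (hu.translate h) hu, symLap_translate] at this
  exact this

lemma deriv_diffQuot {u : ℝ → ℝ} (hu : Differentiable ℝ u) (h : ℝ) :
    deriv (diffQuot h u) = diffQuot h (deriv u) := by
  ext x
  have h1 : HasDerivAt (fun y => u (y + h)) (deriv u (x + h)) x :=
    HasDerivAt.comp_add_const x h (hu (x + h)).hasDerivAt
  exact ((h1.sub (hu x).hasDerivAt).const_mul h⁻¹).deriv

lemma exists_diffQuot_eq {u : ℝ → ℝ} (hu : Differentiable ℝ u) {h : ℝ} (hh : 0 < h) (x : ℝ) :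
    ∃ t ∈ Icc x (x + h), diffQuot h u x = deriv u t := by
  obtain ⟨t, ht, he⟩ := exists_deriv_eq_slope u (lt_add_of_pos_right x hh)
    hu.continuous.continuousOn hu.differentiableOn
  refine ⟨t, Ioo_subset_Icc_self ht, ?_⟩
  rw [he, diffQuot, add_sub_cancel_left, div_eq_inv_mul]

lemma abs_diffQuot_le {u : ℝ → ℝ} (hu : Differentiable ℝ u) {h x K : ℝ} (hh : 0 < h)
    (hK : ∀ t ∈ Icc x (x + h), |deriv u t| ≤ K) : |diffQuot h u x| ≤ K := by
  obtain ⟨t, ht, he⟩ := exists_diffQuot_eq hu hh x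
  rw [he]; exact hK t ht

lemma tendsto_diffQuot {u : ℝ → ℝ} {x d : ℝ} (hu : HasDerivAt u d x) :
    Tendsto (fun h => diffQuot h u x) (𝓝[>] 0) (𝓝 d) :=
  hu.tendsto_slope_zero_right

/-- Differentiation under `symLap`. -/
lemma symLap_deriv {u : ℝ → ℝ} (hu : ContDiff ℝ 3 u) (hb : BddC2 u) {M : ℝ}
    (hM : ∀ x, |deriv u x| ≤ M) {x d : ℝ} (hd : HasDerivAt (symLap u) d x) :
    symLap (deriv u) x = d := by
  have hu0 : Differentiable ℝ u := hu.differentiable (by norm_num)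
  have hu1 : ContDiff ℝ 2 (deriv u) := (contDiff_succ_iff_deriv.1 hu).2.2
  have hu1' : Differentiable ℝ (deriv u) := hu1.differentiable (by norm_num)
  have hu2 : ContDiff ℝ 1 (deriv (deriv u)) := (contDiff_succ_iff_deriv.1 hu1).2.2
  have hu2' : Differentiable ℝ (deriv (deriv u)) := hu2.differentiable (by norm_num)
  have hu3 : Continuous (deriv (deriv (deriv u))) := hu2.continuous_deriv le_rfl
  obtain ⟨K, hK⟩ := (isCompact_Icc (a := x - 1) (b := x + 2)).exists_bound_of_continuousOn
    hu3.continuousOn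
  refine tendsto_nhds_unique ?_ (tendsto_diffQuot hd)
  simp_rw [← symLap_diffQuot hb]
  refine tendsto_integral_filter_of_dominated_convergence
    (fun z : ℝ => (4 * K + 8 * M) * (1 + z ^ 2)⁻¹) ?_ ?_
    (integrable_inv_one_add_sq.const_mul _).integrableOn ?_
  · exact Eventually.of_forall fun h => ((hb.diffQuot h).integrableOn x).aestronglyMeasurable
  · have hI : Ioc (0 : ℝ) 1 ∈ 𝓝[>] (0 : ℝ) := Ioc_mem_nhdsGT one_pos
    filter_upwards [hI] with h hh
    refine (ae_restrict_iff' measurableSet_Ioi).2 (ae_of_all _ fun z hz => ?_)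
    refine abs_secondDiff_div_le (hb.diffQuot h).1 (fun t ht => ?_) (fun t => ?_) hz
    · rw [deriv_diffQuot hu0, deriv_diffQuot hu1']
      exact abs_diffQuot_le hu2' hh.1 fun s hs =>
        hK s ⟨by linarith [ht.1, hs.1], by linarith [ht.2, hs.2, hh.2]⟩
    · exact abs_diffQuot_le hu0 hh.1 fun s _ => hM s
  · refine ae_of_all _ fun z => ?_
    have ht := fun y => tendsto_diffQuot (hu0 y).hasDerivAt
    exact (((ht _).add (ht _)).sub ((ht _).const_mul 2)).div_const _

lemma symLap_lorentz {a : ℝ} (ha : 0 < a) (x : ℝ) :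
    symLap (lorentz a) x = (x ^ 2 - a ^ 2) / (Real.pi * (a ^ 2 + x ^ 2) ^ 2) := by
  have hpi := Real.pi_pos
  have hq : 0 < a ^ 2 + x ^ 2 := by positivity
  have hd : deriv (arctanStep a) = lorentz a := funext fun y => (hasDerivAt_arctanStep ha y).deriv
  rw [← hd]
  refine symLap_deriv contDiff_arctanStep bddC2_arctanStep (M := 1 / (Real.pi * a))
    (fun y => by rw [hd, abs_of_pos (lorentz_pos ha y)]; exact lorentz_le ha y) ?_
  rw [show symLap (arctanStep a) = _ from funext (symLap_arctanStep ha)]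
  have h1 : HasDerivAt (fun y : ℝ => Real.pi * (a ^ 2 + y ^ 2)) (Real.pi * (2 * x)) x := by
    simpa using ((hasDerivAt_pow 2 x).const_add (a ^ 2)).const_mul Real.pi
  refine ((hasDerivAt_id x).div h1 (by positivity)).neg.congr_deriv ?_
  simp only [id]
  field_simp
  ring

lemma symLap_lorentz_le {a : ℝ} (ha : 0 < a) (x : ℝ) :
    symLap (lorentz a) x ≤ a⁻¹ * lorentz a x := by
  have hpi := Real.pi_pos
  have hq : 0 < a ^ 2 + x ^ 2 := by positivity
  have : a⁻¹ * lorentz a x - symLap (lorentz a) x = 2 * a ^ 2 / (Real.pi * (a ^ 2 + x ^ 2) ^ 2) := by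
    rw [symLap_lorentz ha, lorentz]
    field_simp
    ring
  have h2 : 0 ≤ 2 * a ^ 2 / (Real.pi * (a ^ 2 + x ^ 2) ^ 2) := by positivity
  linarith

lemma le_symLap_lorentz {a : ℝ} (ha : 0 < a) {x : ℝ} (hx : 2 * a ≤ |x|) :
    (2 * a)⁻¹ * lorentz a x ≤ symLap (lorentz a) x := by
  have hpi := Real.pi_pos
  have hq : 0 < a ^ 2 + x ^ 2 := by positivity
  have hx2 : 4 * a ^ 2 ≤ x ^ 2 := by rw [← sq_abs x]; nlinarith
  have : symLap (lorentz a) x - (2 * a)⁻¹ * lorentz a x =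
      (x ^ 2 - 3 * a ^ 2) / (2 * Real.pi * (a ^ 2 + x ^ 2) ^ 2) := by
    rw [symLap_lorentz ha, lorentz]
    field_simp
    ring
  have h2 : 0 ≤ (x ^ 2 - 3 * a ^ 2) / (2 * Real.pi * (a ^ 2 + x ^ 2) ^ 2) :=
    div_nonneg (by nlinarith) (by positivity)
  linarith

lemma tendsto_lorentz (a : ℝ) : Tendsto (lorentz a) (cocompact ℝ) (𝓝 0) := by
  have h1 : Tendsto (fun x : ℝ => x ^ 2) (cocompact ℝ) atTop := by
    have := (tendsto_pow_atTop two_ne_zero).comp (tendsto_norm_cocompact_atTop (E := ℝ))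
    simpa [Function.comp_def] using this
  exact ((tendsto_atTop_add_const_left _ (a ^ 2) h1).const_mul_atTop Real.pi_pos).const_div_atTop a

lemma lorentz_le_of_mem_Icc {a x t : ℝ} (ha : 0 < a) (ht : t ∈ Icc x (x + 1)) :
    lorentz a t ≤ (2 + 2 / a ^ 2) * lorentz a x := by
  have hpi := Real.pi_pos
  have h1 : x ^ 2 ≤ 2 * t ^ 2 + 2 := by nlinarith [ht.1, ht.2, sq_nonneg (2 * t - x)]
  have h2 : a ^ 2 + x ^ 2 ≤ (2 + 2 / a ^ 2) * (a ^ 2 + t ^ 2) := by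
    have : (2 + 2 / a ^ 2) * (a ^ 2 + t ^ 2) = 2 * a ^ 2 + 2 * t ^ 2 + 2 + 2 * t ^ 2 / a ^ 2 := by
      field_simp; ring
    have : 0 ≤ 2 * t ^ 2 / a ^ 2 := by positivity
    nlinarith [sq_nonneg a]
  unfold lorentz
  rw [← mul_div_assoc, div_le_div_iff₀ (by positivity) (by positivity)]
  calc a * (Real.pi * (a ^ 2 + x ^ 2)) ≤
      a * (Real.pi * ((2 + 2 / a ^ 2) * (a ^ 2 + t ^ 2))) := by gcongr
    _ = _ := by ring

/-- One-sided barrier estimate. -/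
lemma le_mul_lorentz {v : ℝ → ℝ} (hv : BddC2 v) (hv0 : Tendsto v (cocompact ℝ) (𝓝 0))
    {a c₀ R E C : ℝ} (ha : 0 < a) (hc : a⁻¹ ≤ c₀) (hC : E ≤ C * (c₀ - a⁻¹)) (hC0 : 0 < C)
    (hfar : ∀ x, R < |x| → ∃ c ≥ c₀, c * v x - E * lorentz a x ≤ symLap v x)
    (hnear : ∀ x, |x| ≤ R → v x ≤ C * lorentz a x) (x : ℝ) : v x ≤ C * lorentz a x := by
  have hP := (bddC2_lorentz ha).const_mul C
  have hw := hv.sub hP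
  refine sub_nonpos.1 (nonpos_of_symLap_pos hw.1.continuous ?_ (fun y hy => ?_) x)
  · simpa using hv0.sub ((tendsto_lorentz a).const_mul C)
  · have hPy := lorentz_pos ha y
    have hyR : R < |y| := by
      by_contra! h
      linarith [hnear y h]
    obtain ⟨c, hcc, hle⟩ := hfar y hyR
    rw [symLap_sub hv hP, symLap_const_mul]
    have ha' := inv_pos.2 ha
    have h1 := mul_le_mul_of_nonneg_left (symLap_lorentz_le ha y) hC0.le
    have h2 : 0 < c * (v y - C * lorentz a y) := mul_pos (by linarith) hy
    have h3 : E * lorentz a y ≤ C * (c - a⁻¹) * lorentz a y := by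
      have : C * (c₀ - a⁻¹) ≤ C * (c - a⁻¹) := by gcongr
      gcongr
      linarith
    linarith

/-- Two-sided barrier estimate. -/
lemma abs_le_mul_lorentz {v : ℝ → ℝ} (hv : BddC2 v) (hv0 : Tendsto v (cocompact ℝ) (𝓝 0))
    {a c₀ R E C : ℝ} (ha : 0 < a) (hc : a⁻¹ ≤ c₀) (hC : E ≤ C * (c₀ - a⁻¹)) (hC0 : 0 < C)
    (hfar : ∀ x, R < |x| → ∃ c ≥ c₀, |symLap v x - c * v x| ≤ E * lorentz a x)
    (hnear : ∀ x, |x| ≤ R → |v x| ≤ C * lorentz a x) (x : ℝ) : |v x| ≤ C * lorentz a x := by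
  refine abs_le'.2 ⟨le_mul_lorentz hv hv0 ha hc hC hC0 (fun y hy => ?_)
    (fun y hy => (le_abs_self _).trans (hnear y hy)) x, ?_⟩
  · obtain ⟨c, h1, h2⟩ := hfar y hy
    exact ⟨c, h1, by linarith [(abs_le.1 h2).1]⟩
  · have h := le_mul_lorentz (hv.const_mul (-1)) (by simpa using hv0.const_mul (-1)) ha hc hC hC0
      (R := R) (fun y hy => ?_)
      (fun y hy => by linarith [(neg_abs_le (v y)), hnear y hy]) x
    · linarith
    · obtain ⟨c, h1, h2⟩ := hfar y hy
      refine ⟨c, h1, ?_⟩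
      rw [symLap_const_mul]
      linarith [(abs_le.1 h2).2]

lemma exists_forall_lt_abs {p : ℝ → Prop} (h : ∀ᶠ x in cocompact ℝ, p x) :
    ∃ R : ℝ, 0 < R ∧ ∀ x, R < |x| → p x := by
  rw [cocompact_eq_atBot_atTop, eventually_sup, eventually_atBot, eventually_atTop] at h
  obtain ⟨⟨b, hb⟩, c, hc⟩ := h
  refine ⟨max 1 (max |b| |c|), lt_max_of_lt_left one_pos, fun x hx => ?_⟩
  simp only [max_lt_iff] at hx
  rcases lt_abs.1 hx.2.1 with h1 | h1
  · rcases le_or_gt c x with h2 | h2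
    · exact hc x h2
    · rcases lt_abs.1 hx.2.2 with h3 | h3
      · exact absurd (h2.trans_le (le_abs_self c)) h3.not_gt
      · linarith [abs_nonneg b, abs_nonneg c]
  · exact hb x (by linarith [neg_abs_le b])

lemma tendsto_diffQuot_cocompact {u : ℝ → ℝ} (hu : Tendsto u (cocompact ℝ) (𝓝 0)) (h : ℝ) :
    Tendsto (diffQuot h u) (cocompact ℝ) (𝓝 0) := by
  have h1 := hu.comp (Homeomorph.addRight h).isClosedEmbedding.tendsto_cocompact
  have h2 := (h1.sub hu).const_mul h⁻¹
  rw [sub_self, mul_zero] at h2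
  exact h2

lemma exists_le_mul_lorentz {a : ℝ} (ha : 0 < a) (M R : ℝ) :
    ∃ C > 0, ∀ C' ≥ C, ∀ x, |x| ≤ R → M ≤ C' * lorentz a x := by
  have hR := lorentz_pos ha R
  refine ⟨(|M| + 1) / lorentz a R, by positivity, fun C' hC' x hx => ?_⟩
  have h1 : lorentz a R ≤ lorentz a x := by
    have hpi := Real.pi_pos
    have : x ^ 2 ≤ R ^ 2 := by
      rw [← sq_abs x]
      exact pow_le_pow_left₀ (abs_nonneg x) hx 2
    unfold lorentz
    gcongr
  have hC0 : 0 ≤ C' := le_trans (by positivity) hC'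
  calc M ≤ |M| + 1 := by linarith [le_abs_self M]
    _ = (|M| + 1) / lorentz a R * lorentz a R := by field_simp
    _ ≤ C' * lorentz a x := by gcongr

/-- A barrier estimate on the derivative through uniform estimates of difference quotients. -/
lemma exists_abs_deriv_le_lorentz {u : ℝ → ℝ} (hb : BddC2 u)
    (h0 : ∀ h, Tendsto (diffQuot h u) (cocompact ℝ) (𝓝 0)) {a c₀ R E : ℝ} (ha : 0 < a)
    (hc : a⁻¹ < c₀)
    (hfar : ∀ h ∈ Ioc (0 : ℝ) 1, ∀ x, R < |x| →
      ∃ c ≥ c₀, |diffQuot h (symLap u) x - c * diffQuot h u x| ≤ E * lorentz a x) :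
    ∃ C > 0, ∀ x, |deriv u x| ≤ C * lorentz a x := by
  have hu : Differentiable ℝ u := hb.1.differentiable (by norm_num)
  have hu1 : Continuous (deriv u) := hb.1.continuous_deriv (by norm_num)
  obtain ⟨M, hM⟩ := (isCompact_Icc (a := -R) (b := R + 1)).exists_bound_of_continuousOn
    hu1.continuousOn
  obtain ⟨C₁, hC₁, hnear⟩ := exists_le_mul_lorentz ha M R
  have hgap : 0 < c₀ - a⁻¹ := sub_pos.2 hc
  have hbound : ∀ h ∈ Ioc (0 : ℝ) 1, ∀ x,
      |diffQuot h u x| ≤ max C₁ (E / (c₀ - a⁻¹)) * lorentz a x := by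
    intro h hh x
    refine abs_le_mul_lorentz (hb.diffQuot h) (h0 h) ha hc.le
      (by rw [← div_le_iff₀ hgap]; exact le_max_right _ _) (lt_max_of_lt_left hC₁)
      (R := R) (fun y hy => ?_) (fun y hy => ?_) x
    · rw [symLap_diffQuot hb]
      exact hfar h hh y hy
    · refine le_trans ?_ (hnear _ (le_max_left _ _) y hy)
      rw [abs_le] at hy
      exact abs_diffQuot_le hu hh.1 fun t ht =>
        hM t ⟨by linarith [ht.1], by linarith [ht.2, hh.2]⟩
  refine ⟨max C₁ (E / (c₀ - a⁻¹)), lt_max_of_lt_left hC₁, fun x => ?_⟩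
  refine le_of_tendsto (tendsto_diffQuot (hu x).hasDerivAt).abs ?_
  filter_upwards [Ioc_mem_nhdsGT one_pos] with h hh
  exact hbound h hh x

lemma bddC2_of_abs_le_lorentz {u : ℝ → ℝ} (hu : ContDiff ℝ 2 u) {a C : ℝ} (ha : 0 < a)
    (hC : ∀ x, |u x| ≤ C * lorentz a x) : BddC2 u := by
  have hC0 : 0 ≤ C := nonneg_of_mul_nonneg_left ((abs_nonneg _).trans (hC 0)) (lorentz_pos ha 0)
  exact ⟨hu, C * (1 / (Real.pi * a)), fun x => (hC x).trans (by gcongr; exact lorentz_le ha x)⟩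

lemma tendsto_of_abs_le_lorentz {u : ℝ → ℝ} {a C : ℝ} (hC : ∀ x, |u x| ≤ C * lorentz a x) :
    Tendsto u (cocompact ℝ) (𝓝 0) :=
  squeeze_zero_norm hC (by simpa using (tendsto_lorentz a).const_mul C)

/-- Increasing layer solutions of `symLap φ = f ∘ φ` joining the zeros `0` and `1` of `f`, at which
`f` has the same positive slope `α`. -/
structure IsLayer (f φ : ℝ → ℝ) (α : ℝ) : Prop where
  contDiff_nonlinearity : ContDiff ℝ 3 f
  contDiff : ContDiff ℝ 4 φ
  map_zero : f 0 = 0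
  map_one : f 1 = 0
  deriv_zero : deriv f 0 = α
  deriv_one : deriv f 1 = α
  pos : 0 < α
  symLap_eq : ∀ x, symLap φ x = f (φ x)
  tendsto_atBot : Tendsto φ atBot (𝓝 0)
  tendsto_atTop : Tendsto φ atTop (𝓝 1)
  deriv_pos : ∀ x, 0 < deriv φ x

namespace IsLayer

variable {f φ : ℝ → ℝ} {α : ℝ}

lemma differentiable (h : IsLayer f φ α) : Differentiable ℝ φ :=
  h.contDiff.differentiable (by norm_num)

lemma strictMono (h : IsLayer f φ α) : StrictMono φ := strictMono_of_deriv_pos h.deriv_pos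

lemma mem_Icc (h : IsLayer f φ α) (x : ℝ) : φ x ∈ Icc (0 : ℝ) 1 :=
  ⟨h.strictMono.monotone.le_of_tendsto h.tendsto_atBot x,
    h.strictMono.monotone.ge_of_tendsto h.tendsto_atTop x⟩

lemma bddC2 (h : IsLayer f φ α) : BddC2 φ :=
  ⟨h.contDiff.of_le (by norm_num), 1, fun x => by
    rw [abs_of_nonneg (h.mem_Icc x).1]; exact (h.mem_Icc x).2⟩

lemma exists_abs_comp_le (h : IsLayer f φ α) {g : ℝ → ℝ} (hg : Continuous g) :
    ∃ L : ℝ, 0 ≤ L ∧ ∀ x, |g (φ x)| ≤ L := by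
  obtain ⟨L, hL⟩ := (isCompact_Icc (a := (0 : ℝ)) (b := 1)).exists_bound_of_continuousOn
    hg.continuousOn
  exact ⟨L, (norm_nonneg _).trans (hL _ (h.mem_Icc 0)), fun x => hL _ (h.mem_Icc x)⟩

lemma contDiff_deriv_nonlinearity (h : IsLayer f φ α) : ContDiff ℝ 2 (deriv f) :=
  (contDiff_succ_iff_deriv.1 h.contDiff_nonlinearity).2.2

lemma contDiff_deriv2_nonlinearity (h : IsLayer f φ α) : ContDiff ℝ 1 (deriv (deriv f)) :=
  (contDiff_succ_iff_deriv.1 h.contDiff_deriv_nonlinearity).2.2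

lemma contDiff_deriv (h : IsLayer f φ α) : ContDiff ℝ 3 (deriv φ) :=
  (contDiff_succ_iff_deriv.1 h.contDiff).2.2

lemma contDiff_deriv2 (h : IsLayer f φ α) : ContDiff ℝ 2 (deriv (deriv φ)) :=
  (contDiff_succ_iff_deriv.1 h.contDiff_deriv).2.2

lemma exists_abs_deriv_sub_le (h : IsLayer f φ α) :
    ∃ R : ℝ, 0 < R ∧ ∀ x, R < |x| → ∀ s ∈ Icc (φ x) (φ (x + 1)), |deriv f s - α| ≤ α / 2 := by
  refine exists_forall_lt_abs ?_
  have key : ∀ p : ℝ, deriv f p = α → {s | |deriv f s - α| ≤ α / 2} ∈ 𝓝 p := by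
    intro p hp
    have hc : ContinuousAt (fun s => |deriv f s - α|) p :=
      (h.contDiff_deriv_nonlinearity.continuous.continuousAt.sub continuousAt_const).abs
    refine (hc.eventually_lt_const (u := α / 2) ?_).mono fun _ hs => le_of_lt hs
    simpa [hp] using h.pos
  rw [cocompact_eq_atBot_atTop, eventually_sup]
  constructor
  · have h1 : Tendsto (fun x => φ (x + 1)) atBot (𝓝 0) :=
      h.tendsto_atBot.comp (tendsto_atBot_add_const_right _ 1 tendsto_id)
    exact tendsto_smallSets_iff.1 (h.tendsto_atBot.Icc h1) _ (key 0 h.deriv_zero)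
  · have h1 : Tendsto (fun x => φ (x + 1)) atTop (𝓝 1) :=
      h.tendsto_atTop.comp (tendsto_atTop_add_const_right _ 1 tendsto_id)
    exact tendsto_smallSets_iff.1 (h.tendsto_atTop.Icc h1) _ (key 1 h.deriv_one)

lemma tendsto_diffQuot_cocompact (h : IsLayer f φ α) (k : ℝ) :
    Tendsto (diffQuot k φ) (cocompact ℝ) (𝓝 0) := by
  rw [cocompact_eq_atBot_atTop]
  refine Tendsto.sup ?_ ?_
  · have h1 : Tendsto (fun x => φ (x + k)) atBot (𝓝 0) :=
      h.tendsto_atBot.comp (tendsto_atBot_add_const_right _ k tendsto_id)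
    have h2 := (h1.sub h.tendsto_atBot).const_mul k⁻¹
    rw [sub_self, mul_zero] at h2
    exact h2
  · have h1 : Tendsto (fun x => φ (x + k)) atTop (𝓝 1) :=
      h.tendsto_atTop.comp (tendsto_atTop_add_const_right _ k tendsto_id)
    have h2 := (h1.sub h.tendsto_atTop).const_mul k⁻¹
    rw [sub_self, mul_zero] at h2
    exact h2

lemma exists_diffQuot_symLap_eq (h : IsLayer f φ α) {k : ℝ} (hk : k ∈ Ioc (0 : ℝ) 1) (x : ℝ) :
    ∃ s ∈ Icc (φ x) (φ (x + 1)), diffQuot k (symLap φ) x = deriv f s * diffQuot k φ x := by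
  have hlt : φ x < φ (x + k) := h.strictMono (by linarith [hk.1])
  have hfd : Differentiable ℝ f := h.contDiff_nonlinearity.differentiable (by norm_num)
  obtain ⟨s, hs, he⟩ := exists_deriv_eq_slope f hlt hfd.continuous.continuousOn
    hfd.differentiableOn
  refine ⟨s, ⟨hs.1.le, hs.2.le.trans (h.strictMono.monotone (by linarith [hk.2]))⟩, ?_⟩
  have : φ (x + k) - φ x ≠ 0 := (sub_pos.2 hlt).ne'
  rw [he, diffQuot, diffQuot, h.symLap_eq, h.symLap_eq]
  field_simp

lemma four_div_pos (h : IsLayer f φ α) : 0 < 4 / α := div_pos four_pos h.pos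

lemma exists_abs_deriv_le (h : IsLayer f φ α) :
    ∃ C > 0, ∀ x, |deriv φ x| ≤ C * lorentz (4 / α) x := by
  have hα := h.pos
  obtain ⟨R, -, hR⟩ := h.exists_abs_deriv_sub_le
  refine exists_abs_deriv_le_lorentz h.bddC2 h.tendsto_diffQuot_cocompact h.four_div_pos
    (c₀ := α / 2) (R := R) (E := 0) (by rw [inv_div]; linarith) fun k hk x hx => ?_
  obtain ⟨s, hs, he⟩ := h.exists_diffQuot_symLap_eq hk x
  exact ⟨deriv f s, by linarith [(abs_le.1 (hR x hx s hs)).1], by rw [he]; simp⟩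

lemma exists_le_deriv (h : IsLayer f φ α) :
    ∃ K > 0, ∀ x, K * lorentz (1 / (4 * α)) x ≤ deriv φ x := by
  have hα := h.pos
  have hpi := Real.pi_pos
  set b : ℝ := 1 / (4 * α) with hb
  have hb0 : 0 < b := by positivity
  have hb2 : (2 * b)⁻¹ = 2 * α := by rw [hb]; field_simp; norm_num
  obtain ⟨R₁, hR₁, hR⟩ := h.exists_abs_deriv_sub_le
  set R := max R₁ (2 * b)
  have hRpos : 0 < R := lt_max_of_lt_left hR₁
  obtain ⟨t₀, -, ht₀⟩ := (isCompact_Icc (a := -R) (b := R + 1)).exists_isMinOn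
    (nonempty_Icc.2 (by linarith)) h.contDiff_deriv.continuous.continuousOn
  have hm := h.deriv_pos t₀
  set K := deriv φ t₀ * (Real.pi * b) with hK
  have hK0 : 0 < K := by positivity
  have hP := (bddC2_lorentz hb0).const_mul K
  have hbound : ∀ k ∈ Ioc (0 : ℝ) 1, ∀ x, K * lorentz b x ≤ diffQuot k φ x := by
    intro k hk x
    have hq := h.bddC2.diffQuot k
    refine sub_nonpos.1 (nonpos_of_symLap_pos (hP.sub hq).1.continuous ?_ (fun y hy => ?_) x)
    · simpa using ((tendsto_lorentz b).const_mul K).sub (h.tendsto_diffQuot_cocompact k)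
    · have hyR : R < |y| := by
        by_contra! hle
        rw [abs_le] at hle
        obtain ⟨t, ht, he⟩ := exists_diffQuot_eq h.differentiable hk.1 y
        have h1 : deriv φ t₀ ≤ deriv φ t :=
          ht₀ ⟨by linarith [ht.1], by linarith [ht.2, hk.2]⟩
        have h2 := mul_le_mul_of_nonneg_left (lorentz_le hb0 y) hK0.le
        rw [show K * (1 / (Real.pi * b)) = deriv φ t₀ by rw [hK]; field_simp] at h2
        linarith
      obtain ⟨s, hs, he⟩ := h.exists_diffQuot_symLap_eq hk y
      have hs' := (abs_le.1 (hR y ((le_max_left _ _).trans_lt hyR) s hs)).2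
      have hv : 0 < diffQuot k φ y :=
        mul_pos (inv_pos.2 hk.1) (sub_pos.2 (h.strictMono (by linarith [hk.1])))
      have hlow := le_symLap_lorentz hb0 ((le_max_right R₁ _).trans hyR.le)
      rw [hb2] at hlow
      rw [symLap_sub hP hq, symLap_const_mul, symLap_diffQuot h.bddC2, he]
      have h1 := mul_le_mul_of_nonneg_left hlow hK0.le
      have h2 : deriv f s * diffQuot k φ y ≤ 2 * α * diffQuot k φ y := by gcongr; linarith
      have h3 : 0 < 2 * α * (K * lorentz b y - diffQuot k φ y) := mul_pos (by positivity) hy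
      linarith
  refine ⟨K, hK0, fun x => ?_⟩
  refine ge_of_tendsto (tendsto_diffQuot (h.differentiable x).hasDerivAt) ?_
  filter_upwards [Ioc_mem_nhdsGT one_pos] with k hk
  exact hbound k hk x

/-- Decay of derivatives of solutions of perturbed linearised equations. -/
lemma exists_abs_deriv_le_of_linearized (h : IsLayer f φ α) {u e : ℝ → ℝ} (hu : ContDiff ℝ 2 u)
    (he : Differentiable ℝ e) {C E : ℝ} (hC : ∀ x, |u x| ≤ C * lorentz (4 / α) x)
    (hE : ∀ x, |deriv e x| ≤ E * lorentz (4 / α) x)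
    (hS : ∀ x, symLap u x = deriv f (φ x) * u x + e x) :
    ∃ C > 0, ∀ x, |deriv u x| ≤ C * lorentz (4 / α) x := by
  have hα := h.pos
  have ha := h.four_div_pos
  set a := 4 / α with haa
  obtain ⟨R, -, hR⟩ := h.exists_abs_deriv_sub_le
  have hf1 : Differentiable ℝ (deriv f) := h.contDiff_deriv_nonlinearity.differentiable (by norm_num)
  obtain ⟨L, hL0, hL⟩ := h.exists_abs_comp_le h.contDiff_deriv2_nonlinearity.continuous
  obtain ⟨C₁, hC₁, hφ'⟩ := h.exists_abs_deriv_le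
  have hE0 : 0 ≤ E := nonneg_of_mul_nonneg_left ((abs_nonneg _).trans (hE 0)) (lorentz_pos ha 0)
  set c : ℝ → ℝ := fun x => deriv f (φ x) with hc
  have hcd : ∀ x, HasDerivAt c (deriv (deriv f) (φ x) * deriv φ x) x := fun x =>
    (hf1 _).hasDerivAt.comp x (h.differentiable x).hasDerivAt
  set L' := L * (C₁ * (1 / (Real.pi * a))) with hL'
  have hcb : ∀ x, |deriv c x| ≤ L' := by
    intro x
    rw [(hcd x).deriv, abs_mul]
    have h1 := (hφ' x).trans (mul_le_mul_of_nonneg_left (lorentz_le ha x) hC₁.le)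
    exact mul_le_mul (hL x) h1 (abs_nonneg _) hL0
  have hb := bddC2_of_abs_le_lorentz hu ha hC
  refine exists_abs_deriv_le_lorentz hb
    (_root_.tendsto_diffQuot_cocompact (tendsto_of_abs_le_lorentz hC)) ha
    (c₀ := α / 2) (R := R) (E := L' * C + E * (2 + 2 / a ^ 2))
    (by rw [haa, inv_div]; linarith) fun k hk x hx => ?_
  have hmem : φ (x + k) ∈ Icc (φ x) (φ (x + 1)) :=
    ⟨h.strictMono.monotone (by linarith [hk.1]), h.strictMono.monotone (by linarith [hk.2])⟩
  refine ⟨c (x + k), by linarith [(abs_le.1 (hR x hx _ hmem)).1], ?_⟩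
  have hsplit : diffQuot k (symLap u) x - c (x + k) * diffQuot k u x =
      diffQuot k c x * u x + diffQuot k e x := by
    simp only [diffQuot, hS, hc]
    ring
  have h1 : |diffQuot k c x| ≤ L' :=
    abs_diffQuot_le (fun y => (hcd y).differentiableAt) hk.1 fun t _ => hcb t
  have h2 : |diffQuot k e x| ≤ E * ((2 + 2 / a ^ 2) * lorentz a x) :=
    abs_diffQuot_le he hk.1 fun t ht => (hE t).trans (by
      gcongr
      exact lorentz_le_of_mem_Icc ha ⟨ht.1, by linarith [ht.2, hk.2]⟩)
  rw [hsplit]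
  calc |diffQuot k c x * u x + diffQuot k e x|
      ≤ |diffQuot k c x| * |u x| + |diffQuot k e x| := by
        rw [← abs_mul]; exact abs_add_le _ _
    _ ≤ L' * (C * lorentz a x) + E * ((2 + 2 / a ^ 2) * lorentz a x) := by
        gcongr
        exact hC x
    _ = _ := by ring

lemma symLap_deriv_eq (h : IsLayer f φ α) (x : ℝ) :
    symLap (deriv φ) x = deriv f (φ x) * deriv φ x := by
  obtain ⟨C, hC0, hC⟩ := h.exists_abs_deriv_le
  have hfd : Differentiable ℝ f := h.contDiff_nonlinearity.differentiable (by norm_num)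
  obtain ⟨-, M, hM⟩ := bddC2_of_abs_le_lorentz (h.contDiff_deriv.of_le (by norm_num))
    h.four_div_pos hC
  refine symLap_deriv (h.contDiff.of_le (by norm_num)) h.bddC2 hM ?_
  rw [show symLap φ = fun x => f (φ x) from funext h.symLap_eq]
  exact (hfd _).hasDerivAt.comp x (h.differentiable x).hasDerivAt

lemma exists_abs_deriv2_le (h : IsLayer f φ α) :
    ∃ C > 0, ∀ x, |deriv (deriv φ) x| ≤ C * lorentz (4 / α) x := by
  obtain ⟨C, hC0, hC⟩ := h.exists_abs_deriv_le
  exact h.exists_abs_deriv_le_of_linearized (h.contDiff_deriv.of_le (by norm_num))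
    (differentiable_const 0) hC (E := 0) (by simp) (by simpa using h.symLap_deriv_eq)

lemma symLap_deriv2_eq (h : IsLayer f φ α) (x : ℝ) :
    symLap (deriv (deriv φ)) x =
      deriv f (φ x) * deriv (deriv φ) x + deriv (deriv f) (φ x) * deriv φ x ^ 2 := by
  obtain ⟨C, hC0, hC⟩ := h.exists_abs_deriv_le
  obtain ⟨C', hC'0, hC'⟩ := h.exists_abs_deriv2_le
  have hf1 : Differentiable ℝ (deriv f) := h.contDiff_deriv_nonlinearity.differentiable (by norm_num)
  have hd1 : Differentiable ℝ (deriv φ) := h.contDiff_deriv.differentiable (by norm_num)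
  have hb := bddC2_of_abs_le_lorentz (h.contDiff_deriv.of_le (by norm_num)) h.four_div_pos hC
  obtain ⟨-, M, hM⟩ := bddC2_of_abs_le_lorentz h.contDiff_deriv2 h.four_div_pos hC'
  refine symLap_deriv h.contDiff_deriv hb hM ?_
  rw [show symLap (deriv φ) = fun x => deriv f (φ x) * deriv φ x from funext h.symLap_deriv_eq]
  exact (((hf1 _).hasDerivAt.comp x (h.differentiable x).hasDerivAt).mul
    (hd1 x).hasDerivAt).congr_deriv (by simp only [Function.comp_apply]; ring)

lemma exists_abs_deriv3_le (h : IsLayer f φ α) :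
    ∃ C > 0, ∀ x, |deriv (deriv (deriv φ)) x| ≤ C * lorentz (4 / α) x := by
  obtain ⟨C, hC0, hC⟩ := h.exists_abs_deriv_le
  obtain ⟨C', hC'0, hC'⟩ := h.exists_abs_deriv2_le
  obtain ⟨-, M, hM⟩ := bddC2_of_abs_le_lorentz (h.contDiff_deriv.of_le (by norm_num))
    h.four_div_pos hC
  have hM0 : 0 ≤ M := (abs_nonneg _).trans (hM 0)
  have hf2 : Differentiable ℝ (deriv (deriv f)) :=
    h.contDiff_deriv2_nonlinearity.differentiable (by norm_num)
  have hd1 : Differentiable ℝ (deriv φ) := h.contDiff_deriv.differentiable (by norm_num)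
  obtain ⟨L₂, hL₂0, hL₂⟩ := h.exists_abs_comp_le hf2.continuous
  obtain ⟨L₃, hL₃0, hL₃⟩ := h.exists_abs_comp_le
    (h.contDiff_deriv2_nonlinearity.continuous_deriv le_rfl)
  have hder : ∀ x, HasDerivAt (fun x => deriv (deriv f) (φ x) * deriv φ x ^ 2)
      (deriv (deriv (deriv f)) (φ x) * deriv φ x ^ 2 * deriv φ x +
        2 * (deriv (deriv f) (φ x) * deriv φ x * deriv (deriv φ) x)) x := by
    intro x
    exact (((hf2 _).hasDerivAt.comp x (h.differentiable x).hasDerivAt).mul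
      ((hd1 x).hasDerivAt.pow 2)).congr_deriv (by
        simp only [Function.comp_apply, Pi.pow_apply]; push_cast; ring)
  refine h.exists_abs_deriv_le_of_linearized h.contDiff_deriv2
    (fun x => (hder x).differentiableAt) hC' (E := L₃ * M ^ 2 * C + 2 * (L₂ * M * C'))
    (fun x => ?_) h.symLap_deriv2_eq
  rw [(hder x).deriv]
  refine (abs_add_le _ _).trans ?_
  simp only [abs_mul, abs_pow, abs_two]
  calc _ ≤ L₃ * M ^ 2 * (C * lorentz (4 / α) x) + 2 * (L₂ * M * (C' * lorentz (4 / α) x)) := by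
        gcongr
        exacts [hL₃ x, hM x, hC x, hL₂ x, hM x, hC' x]
    _ = _ := by ring

end IsLayer

lemma abs_arctan_sub_le (s : ℝ) : |Real.arctan s - s| ≤ s ^ 2 := by
  have hder : ∀ t, HasDerivAt (fun t => Real.arctan t - t) (1 / (1 + t ^ 2) - 1) t := fun t =>
    (Real.hasDerivAt_arctan t).sub (hasDerivAt_id t)
  have := (convex_closedBall (0 : ℝ) |s|).norm_image_sub_le_of_norm_hasDerivWithin_le
      (f := fun t => Real.arctan t - t) (C := |s|) (fun t _ => (hder t).hasDerivWithinAt)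
      (fun t ht => by
        rw [mem_closedBall, dist_zero_right, Real.norm_eq_abs] at ht
        refine le_trans ?_ ht
        have h1 : 1 / (1 + t ^ 2) - 1 = -(t ^ 2 / (1 + t ^ 2)) := by field_simp; ring
        rw [Real.norm_eq_abs, h1, abs_neg, abs_of_nonneg (by positivity),
          div_le_iff₀ (by positivity), ← sq_abs t]
        nlinarith [abs_nonneg t, mul_nonneg (abs_nonneg t) (sq_nonneg (|t| - 1)),
          sq_nonneg (|t| - 1)])
      (x := 0) (y := s) (by simp) (by simp)
  simpa [Real.norm_eq_abs, ← sq] using this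

lemma abs_arctan_sub_div_le (s : ℝ) : |s / (1 + s ^ 2) - Real.arctan s| ≤ 2 * s ^ 2 := by
  have h1 : |s / (1 + s ^ 2) - s| ≤ s ^ 2 := by
    have h2 : s / (1 + s ^ 2) - s = -(s * s ^ 2 / (1 + s ^ 2)) := by field_simp; ring
    rw [h2, abs_neg, abs_div, abs_of_pos (by positivity : 0 < 1 + s ^ 2),
      div_le_iff₀ (by positivity), abs_mul, abs_of_nonneg (sq_nonneg s), ← sq_abs s]
    have h0 := abs_nonneg s
    nlinarith [mul_nonneg (sq_nonneg |s|) (sq_nonneg (|s| - 1)), sq_nonneg (|s|),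
      mul_nonneg (sq_nonneg |s|) h0]
  calc |s / (1 + s ^ 2) - Real.arctan s|
      = |(s / (1 + s ^ 2) - s) - (Real.arctan s - s)| := by ring_nf
    _ ≤ |s / (1 + s ^ 2) - s| + |Real.arctan s - s| := abs_sub _ _
    _ ≤ 2 * s ^ 2 := by linarith [abs_arctan_sub_le s]

lemma arctanStep_sub_heaviside {a x : ℝ} (ha : 0 < a) (hx : x ≠ 0) :
    arctanStep a x - Heaviside x = -(Real.arctan (a / x) / Real.pi) := by
  have hpi := Real.pi_pos
  rw [← inv_div x a]
  rcases lt_or_gt_of_ne hx with h | h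
  · rw [Real.arctan_inv_of_neg (div_neg_of_neg_of_pos h ha), Heaviside, if_neg h.not_ge, arctanStep]
    field_simp
    ring
  · rw [Real.arctan_inv_of_pos (div_pos h ha), Heaviside, if_pos h.le, arctanStep]
    field_simp
    ring

lemma lorentz_le_div {a : ℝ} (ha : 0 < a) (x : ℝ) :
    lorentz a x ≤ a / Real.pi * (1 + 1 / a ^ 2) / (1 + x ^ 2) := by
  have hpi := Real.pi_pos
  have h1 : 1 + x ^ 2 ≤ (1 + 1 / a ^ 2) * (a ^ 2 + x ^ 2) := by
    have h2 : (1 + 1 / a ^ 2) * (a ^ 2 + x ^ 2) = a ^ 2 + x ^ 2 + 1 + x ^ 2 / a ^ 2 := by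
      field_simp
      ring
    have h3 : 0 ≤ x ^ 2 / a ^ 2 := by positivity
    nlinarith [sq_nonneg a]
  unfold lorentz
  rw [div_le_div_iff₀ (by positivity) (by positivity)]
  calc a * (1 + x ^ 2) ≤ a * ((1 + 1 / a ^ 2) * (a ^ 2 + x ^ 2)) := by gcongr
    _ = _ := by field_simp

lemma div_le_lorentz {a : ℝ} (ha : 0 < a) (x : ℝ) :
    a / Real.pi / (1 + a ^ 2) / (1 + x ^ 2) ≤ lorentz a x := by
  have hpi := Real.pi_pos
  unfold lorentz
  rw [div_div, div_div, div_le_div_iff_of_pos_left ha (by positivity) (by positivity)]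
  gcongr
  nlinarith [mul_nonneg (sq_nonneg a) (sq_nonneg x)]

lemma inv_sq_le_lorentz {a x : ℝ} (ha : 0 < a) (hx : 1 ≤ |x|) :
    1 / x ^ 2 ≤ Real.pi * (1 + a ^ 2) / a * lorentz a x := by
  have hpi := Real.pi_pos
  have hx2 : 1 ≤ x ^ 2 := by rw [← sq_abs]; nlinarith
  have h1 : Real.pi * (1 + a ^ 2) / a * lorentz a x = (1 + a ^ 2) / (a ^ 2 + x ^ 2) := by
    unfold lorentz
    field_simp
  rw [h1, div_le_div_iff₀ (by positivity) (by positivity)]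
  nlinarith [mul_nonneg (sq_nonneg a) (sub_nonneg.2 hx2)]

namespace IsLayer

variable {f φ : ℝ → ℝ} {α : ℝ}

lemma exists_abs_sub_heaviside_le (h : IsLayer f φ α) :
    ∃ D > 0, ∀ x ≠ 0, |φ x - Heaviside x| ≤ D / |x| := by
  obtain ⟨C, hC0, hC⟩ := h.exists_abs_deriv_le
  have ha := h.four_div_pos
  generalize 4 / α = a at hC ha
  have hpi := Real.pi_pos
  set D := C * (a / Real.pi) with hD
  have hD0 : 0 < D := by positivity
  have hφ' : ∀ x ≠ 0, deriv φ x ≤ D / x ^ 2 := by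
    intro x hx
    refine (le_abs_self _).trans ((hC x).trans ?_)
    rw [hD, mul_div_assoc, lorentz, div_div]
    have : 0 < x ^ 2 := by positivity
    gcongr
    nlinarith [sq_nonneg a]
  have hder : ∀ x ≠ 0, HasDerivAt (fun x => φ x + D / x) (deriv φ x - D / x ^ 2) x := by
    intro x hx
    have h1 := (hasDerivAt_inv hx).const_mul D
    refine ((h.differentiable x).hasDerivAt.add h1).congr_deriv ?_
    field_simp
    ring
  have hanti : ∀ s : Set ℝ, Convex ℝ s → IsOpen s → (∀ x ∈ s, x ≠ 0) →
      AntitoneOn (fun x => φ x + D / x) s := by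
    intro s hs ho hne
    refine antitoneOn_of_deriv_nonpos hs
      (fun x hx => (hder x (hne x hx)).continuousAt.continuousWithinAt)
      (fun x hx => (hder x (hne x (interior_subset hx))).differentiableAt.differentiableWithinAt)
      fun x hx => ?_
    rw [(hder x (hne x (interior_subset hx))).deriv]
    linarith [hφ' x (hne x (interior_subset hx))]
  refine ⟨D, hD0, fun x hx => ?_⟩
  rcases lt_or_gt_of_ne hx with h0 | h0
  · have hlim : Tendsto (fun x => φ x + D / x) atBot (𝓝 0) := by
      simpa using h.tendsto_atBot.add (tendsto_const_nhds.div_atBot tendsto_id (a := D))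
    have h1 : φ x + D / x ≤ 0 := by
      refine ge_of_tendsto hlim ?_
      filter_upwards [eventually_le_atBot x] with y hy
      exact hanti (Iio 0) (convex_Iio 0) isOpen_Iio (fun z hz => ne_of_lt hz)
        (mem_Iio.2 (hy.trans_lt h0)) (mem_Iio.2 h0) hy
    rw [Heaviside, if_neg h0.not_ge, sub_zero, abs_of_nonneg (h.mem_Icc x).1, abs_of_neg h0,
      div_neg]
    linarith
  · have hlim : Tendsto (fun x => φ x + D / x) atTop (𝓝 1) := by
      simpa using h.tendsto_atTop.add (tendsto_const_nhds.div_atTop tendsto_id (a := D))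
    have h1 : 1 ≤ φ x + D / x := by
      refine le_of_tendsto hlim ?_
      filter_upwards [eventually_ge_atTop x] with y hy
      exact hanti (Ioi 0) (convex_Ioi 0) isOpen_Ioi (fun z hz => ne_of_gt hz)
        (mem_Ioi.2 h0) (mem_Ioi.2 (h0.trans_le hy)) hy
    rw [Heaviside, if_pos h0.le, abs_of_nonpos (by linarith [(h.mem_Icc x).2]), abs_of_pos h0]
    linarith

lemma exists_abs_nonlinearity_sub_le (h : IsLayer f φ α) :
    ∃ K > 0, ∀ x, |f (φ x) - α * (φ x - Heaviside x)| ≤ K * (φ x - Heaviside x) ^ 2 := by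
  have hf := h.contDiff_nonlinearity.of_le (m := 2) (by norm_num)
  obtain ⟨K₀, hK₀⟩ := _root_.exists_abs_deriv2_le hf 0
  obtain ⟨K₁, hK₁⟩ := _root_.exists_abs_deriv2_le hf 1
  refine ⟨max 1 (max K₀ K₁), lt_max_of_lt_left one_pos, fun x => ?_⟩
  have hm := h.mem_Icc x
  rcases lt_or_ge x 0 with h0 | h0
  · rw [Heaviside, if_neg h0.not_ge]
    have := abs_taylor_one_le hf hK₀ (y := φ x) (by
      rw [abs_le]; constructor <;> linarith [hm.1, hm.2])
    rw [h.map_zero, h.deriv_zero, sub_zero] at this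
    refine this.trans ?_
    gcongr
    simp
  · rw [Heaviside, if_pos h0]
    have := abs_taylor_one_le hf hK₁ (y := φ x) (by
      rw [abs_le]; constructor <;> linarith [hm.1, hm.2])
    rw [h.map_one, h.deriv_one, sub_zero] at this
    refine this.trans ?_
    gcongr
    simp

lemma exists_abs_sub_arctanStep_le (h : IsLayer f φ α) :
    ∃ C > 0, ∀ x, |φ x - arctanStep α⁻¹ x| ≤ C * lorentz (4 / α) x := by
  have hα := h.pos
  have hpi := Real.pi_pos
  have ha := h.four_div_pos
  have hα' := inv_pos.2 hα
  set a := 4 / α with haa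
  obtain ⟨D, hD0, hD⟩ := h.exists_abs_sub_heaviside_le
  obtain ⟨K, hK0, hK⟩ := h.exists_abs_nonlinearity_sub_le
  have hw := h.bddC2.sub (bddC2_arctanStep (a := α⁻¹))
  obtain ⟨C₁, hC₁, hnear⟩ := exists_le_mul_lorentz ha 2 1
  set E := (K * D ^ 2 + 2 / (Real.pi * α)) * (Real.pi * (1 + a ^ 2) / a) with hE
  have hgap : 0 < α / 2 - a⁻¹ := by rw [haa, inv_div]; linarith
  have hψ : ∀ x ≠ 0, |arctanStep α⁻¹ x - Heaviside x| ≤ (α⁻¹ + α⁻¹ ^ 2) / |x| ∨ |x| < 1 := by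
    intro x hx
    refine or_iff_not_imp_right.2 fun h1 => ?_
    have h1 : 1 ≤ |x| := not_lt.1 h1
    have h0 : 0 < |x| := abs_pos.2 hx
    rw [arctanStep_sub_heaviside hα' hx, abs_neg, abs_div, abs_of_pos hpi]
    have h3 : |Real.arctan (α⁻¹ / x)| ≤ α⁻¹ / |x| + (α⁻¹ / |x|) ^ 2 := by
      have h4 := abs_arctan_sub_le (α⁻¹ / x)
      have h5 := abs_sub_abs_le_abs_sub (Real.arctan (α⁻¹ / x)) (α⁻¹ / x)
      have h6 : |α⁻¹ / x| = α⁻¹ / |x| := by rw [abs_div, abs_of_pos hα']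
      rw [← sq_abs, h6] at h4
      rw [h6] at h5
      linarith
    calc |Real.arctan (α⁻¹ / x)| / Real.pi ≤ |Real.arctan (α⁻¹ / x)| / 1 := by
          gcongr; linarith [Real.pi_gt_three]
      _ ≤ α⁻¹ / |x| + (α⁻¹ / |x|) ^ 2 := by rwa [div_one]
      _ = α⁻¹ / |x| + α⁻¹ ^ 2 / (|x| * |x|) := by rw [div_pow, sq |x|]
      _ ≤ α⁻¹ / |x| + α⁻¹ ^ 2 / (|x| * 1) := by gcongr
      _ = _ := by rw [mul_one, add_div]
  have hw0 : Tendsto (fun x => φ x - arctanStep α⁻¹ x) (cocompact ℝ) (𝓝 0) := by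
    refine squeeze_zero_norm' (a := fun x : ℝ => (D + (α⁻¹ + α⁻¹ ^ 2)) / |x|) ?_
      (tendsto_const_nhds.div_atTop tendsto_norm_cocompact_atTop)
    filter_upwards [(tendsto_norm_cocompact_atTop (E := ℝ)).eventually_ge_atTop 1] with x hx
    rw [Real.norm_eq_abs] at hx
    have hx0 : x ≠ 0 := abs_pos.1 (one_pos.trans_le hx)
    have h1 := hD x hx0
    have h2 := (hψ x hx0).resolve_right hx.not_gt
    rw [Real.norm_eq_abs, add_div]
    calc |φ x - arctanStep α⁻¹ x|
        = |(φ x - Heaviside x) - (arctanStep α⁻¹ x - Heaviside x)| := by ring_nf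
      _ ≤ _ := (abs_sub _ _).trans (add_le_add h1 h2)
  refine ⟨max C₁ (E / (α / 2 - a⁻¹)), lt_max_of_lt_left hC₁, fun x => ?_⟩
  refine abs_le_mul_lorentz hw hw0 ha (c₀ := α / 2) (R := 1) (E := E) (by linarith)
    (by rw [← div_le_iff₀ hgap]; exact le_max_right _ _) (lt_max_of_lt_left hC₁)
    (fun y hy => ⟨α, by linarith, ?_⟩) (fun y hy => ?_) x
  · have hy0 : y ≠ 0 := abs_pos.1 (one_pos.trans hy)
    rw [symLap_sub h.bddC2 bddC2_arctanStep, h.symLap_eq, symLap_arctanStep hα']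
    have e1 : |f (φ y) - α * (φ y - Heaviside y)| ≤ K * D ^ 2 * (1 / y ^ 2) := by
      refine (hK y).trans ?_
      have h1 := pow_le_pow_left₀ (abs_nonneg _) (hD y hy0) 2
      rw [sq_abs, div_pow, sq_abs] at h1
      calc _ ≤ K * (D ^ 2 / y ^ 2) := by gcongr
        _ = _ := by ring
    have e2 : y / (Real.pi * (α⁻¹ ^ 2 + y ^ 2)) + α * (arctanStep α⁻¹ y - Heaviside y) =
        α / Real.pi * ((α⁻¹ / y) / (1 + (α⁻¹ / y) ^ 2) - Real.arctan (α⁻¹ / y)) := by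
      rw [arctanStep_sub_heaviside hα' hy0]
      have : 0 < y ^ 2 := by positivity
      field_simp
      ring
    have e3 : |y / (Real.pi * (α⁻¹ ^ 2 + y ^ 2)) + α * (arctanStep α⁻¹ y - Heaviside y)| ≤
        2 / (Real.pi * α) * (1 / y ^ 2) := by
      rw [e2, abs_mul, abs_of_pos (div_pos hα hpi)]
      calc _ ≤ α / Real.pi * (2 * (α⁻¹ / y) ^ 2) := by gcongr; exact abs_arctan_sub_div_le _
        _ = _ := by field_simp
    calc _ = |(f (φ y) - α * (φ y - Heaviside y)) + (y / (Real.pi * (α⁻¹ ^ 2 + y ^ 2)) +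
          α * (arctanStep α⁻¹ y - Heaviside y))| := by ring_nf
      _ ≤ K * D ^ 2 * (1 / y ^ 2) + 2 / (Real.pi * α) * (1 / y ^ 2) :=
          (abs_add_le _ _).trans (add_le_add e1 e3)
      _ = (K * D ^ 2 + 2 / (Real.pi * α)) * (1 / y ^ 2) := by ring
      _ ≤ (K * D ^ 2 + 2 / (Real.pi * α)) * (Real.pi * (1 + a ^ 2) / a * lorentz a y) := by
          gcongr
          exact inv_sq_le_lorentz ha hy.le
      _ = _ := by rw [hE]; ring
  · refine le_trans ?_ (hnear _ (le_max_left _ _) y hy)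
    refine (abs_sub _ _).trans ?_
    have h1 := abs_arctanStep_le (a := α⁻¹) y
    have h2 : |φ y| ≤ 1 := by rw [abs_of_nonneg (h.mem_Icc y).1]; exact (h.mem_Icc y).2
    linarith

lemma exists_abs_sub_heaviside_add_le (h : IsLayer f φ α) :
    ∃ K > 0, ∀ x, 1 ≤ |x| → |φ x - Heaviside x + 1 / (α * Real.pi * x)| ≤ K / x ^ 2 := by
  have hα := h.pos
  have hpi := Real.pi_pos
  have ha := h.four_div_pos
  obtain ⟨C, hC0, hC⟩ := h.exists_abs_sub_arctanStep_le
  set a := 4 / α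
  set κ := a / Real.pi * (1 + 1 / a ^ 2) with hκ
  have hκ0 : 0 < κ := by positivity
  refine ⟨C * κ + 1 / (Real.pi * α ^ 2), by positivity, fun x hx => ?_⟩
  have hx0 : x ≠ 0 := abs_pos.1 (one_pos.trans_le hx)
  have hx2 : 0 < x ^ 2 := by positivity
  have e1 : |φ x - arctanStep α⁻¹ x| ≤ C * (κ / x ^ 2) := by
    refine (hC x).trans ?_
    gcongr
    refine (lorentz_le_div ha x).trans ?_
    rw [← hκ]
    gcongr
    linarith
  have e2 : arctanStep α⁻¹ x - Heaviside x + 1 / (α * Real.pi * x) =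
      -(1 / Real.pi * (Real.arctan (α⁻¹ / x) - α⁻¹ / x)) := by
    rw [arctanStep_sub_heaviside (inv_pos.2 hα) hx0]
    field_simp
    ring
  have e3 : |arctanStep α⁻¹ x - Heaviside x + 1 / (α * Real.pi * x)| ≤
      1 / Real.pi * (α⁻¹ / x) ^ 2 := by
    rw [e2, abs_neg, abs_mul, abs_of_pos (by positivity : 0 < 1 / Real.pi)]
    gcongr
    exact abs_arctan_sub_le _
  calc _ = |(φ x - arctanStep α⁻¹ x) +
        (arctanStep α⁻¹ x - Heaviside x + 1 / (α * Real.pi * x))| := by ring_nf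
    _ ≤ C * (κ / x ^ 2) + 1 / Real.pi * (α⁻¹ / x) ^ 2 :=
        (abs_add_le _ _).trans (add_le_add e1 e3)
    _ = _ := by field_simp

end IsLayer

lemma IsPhi.isLayer {W φ : ℝ → ℝ} (hW : AssumptionW W) (hφ : IsPhi W φ) :
    IsLayer (deriv W) φ (deriv (deriv W) 0) := by
  obtain ⟨⟨-, -, hWd, -⟩, hper, hzero, hpos, hα⟩ := hW
  obtain ⟨hφd, heq, hbot, htop, -, hder⟩ := hφ
  have hnonneg : ∀ v, 0 ≤ W v := by
    intro v
    by_cases h : ∀ k : ℤ, v ≠ (k : ℝ)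
    · exact (hpos v h).le
    · push Not at h
      obtain ⟨k, rfl⟩ := h
      exact (hzero k).ge
  have hW0 : W 0 = 0 := by simpa using hzero 0
  have hW1 : deriv W 0 = 0 :=
    IsLocalMin.deriv_eq_zero (Eventually.of_forall fun v => by rw [hW0]; exact hnonneg v)
  have hper1 : ∀ v, deriv W (v + 1) = deriv W v := by
    intro v
    rw [← deriv_comp_add_const, show (fun x => W (x + 1)) = W from funext hper]
  have hper2 : ∀ v, deriv (deriv W) (v + 1) = deriv (deriv W) v := by
    intro v
    rw [← deriv_comp_add_const, show (fun x => deriv W (x + 1)) = deriv W from funext hper1]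
  have hmono : StrictMono φ := strictMono_of_deriv_pos hder
  have hb : BddC2 φ := ⟨hφd.of_le (by norm_num), 1, fun x => abs_le.2
    ⟨by linarith [hmono.monotone.le_of_tendsto hbot x], hmono.monotone.ge_of_tendsto htop x⟩⟩
  exact
    { contDiff_nonlinearity := (contDiff_succ_iff_deriv.1 hWd).2.2
      contDiff := hφd
      map_zero := hW1
      map_one := by simpa [hW1] using hper1 0
      deriv_zero := rfl
      deriv_one := by simpa using hper2 0
      pos := hα
      symLap_eq := fun x => by rw [← hb.halfLap_eq, heq]
      tendsto_atBot := hbot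
      tendsto_atTop := htop
      deriv_pos := hder }

/-- **Behavior of `φ` at infinity** (Lemma 6.3).  Assume (W) with `N = 1` and `g ≡ 1/π`,
and let `φ` be the phase transition.  Then there are `K0, K1 > 0` with
`|φ(x) − H(x) + 1/(απx)| ≤ K1/x²` for `|x| ≥ 1` (`α = W''(0)`), and for all `x`:
`0 < K0/(1+x²) ≤ φ'(x) ≤ K1/(1+x²)`, `|φ''(x)| ≤ K1/(1+x²)`, `|φ'''(x)| ≤ K1/(1+x²)`. -/
theorem phi_behavior (W : ℝ → ℝ) (hW : AssumptionW W) (φ : ℝ → ℝ) (hφ : IsPhi W φ) :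
    ∃ K0 > (0:ℝ), ∃ K1 > (0:ℝ),
      (∀ x : ℝ, 1 ≤ |x| →
        |φ x - Heaviside x + 1 / (deriv (deriv W) 0 * Real.pi * x)| ≤ K1 / x ^ 2) ∧
      (∀ x : ℝ, 0 < K0 / (1 + x ^ 2) ∧ K0 / (1 + x ^ 2) ≤ deriv φ x ∧
        deriv φ x ≤ K1 / (1 + x ^ 2)) ∧
      (∀ x : ℝ, -(K1 / (1 + x ^ 2)) ≤ iteratedDeriv 2 φ x ∧
        iteratedDeriv 2 φ x ≤ K1 / (1 + x ^ 2)) ∧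
      (∀ x : ℝ, -(K1 / (1 + x ^ 2)) ≤ iteratedDeriv 3 φ x ∧
        iteratedDeriv 3 φ x ≤ K1 / (1 + x ^ 2)) := by
  have h := hφ.isLayer hW
  have ha := h.four_div_pos
  have hα := h.pos
  have hpi := Real.pi_pos
  obtain ⟨A, hA0, hA⟩ := h.exists_abs_sub_heaviside_add_le
  obtain ⟨B, hB0, hB⟩ := h.exists_le_deriv
  obtain ⟨C₁, hC₁0, hC₁⟩ := h.exists_abs_deriv_le
  obtain ⟨C₂, hC₂0, hC₂⟩ := h.exists_abs_deriv2_le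
  obtain ⟨C₃, hC₃0, hC₃⟩ := h.exists_abs_deriv3_le
  set α := deriv (deriv W) 0
  set a := 4 / α
  set b := 1 / (4 * α)
  have hb : 0 < b := by positivity
  set κ := a / Real.pi * (1 + 1 / a ^ 2) with hκ
  have hκ0 : 0 < κ := by positivity
  set K := A + (C₁ + C₂ + C₃) * κ with hK
  have hK0 : 0 < K := by positivity
  have hup : ∀ {u : ℝ → ℝ} {C : ℝ}, 0 < C → C ≤ C₁ + C₂ + C₃ →
      (∀ x, |u x| ≤ C * lorentz a x) → ∀ x, |u x| ≤ K / (1 + x ^ 2) := by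
    intro u C hC0 hC hu x
    calc |u x| ≤ C * (κ / (1 + x ^ 2)) :=
          (hu x).trans (mul_le_mul_of_nonneg_left (lorentz_le_div ha x) hC0.le)
      _ ≤ (C₁ + C₂ + C₃) * (κ / (1 + x ^ 2)) := by gcongr
      _ = (C₁ + C₂ + C₃) * κ / (1 + x ^ 2) := by ring
      _ ≤ K / (1 + x ^ 2) := by gcongr; linarith
  have hit2 : iteratedDeriv 2 φ = deriv (deriv φ) := by
    rw [iteratedDeriv_succ, iteratedDeriv_one]
  have hit3 : iteratedDeriv 3 φ = deriv (deriv (deriv φ)) := by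
    rw [iteratedDeriv_succ, hit2]
  refine ⟨B * (b / Real.pi / (1 + b ^ 2)), by positivity, K, hK0, fun x hx => ?_, fun x => ?_,
    fun x => ?_, fun x => ?_⟩
  · refine (hA x hx).trans ?_
    gcongr
    have : 0 < (C₁ + C₂ + C₃) * κ := by positivity
    linarith
  · refine ⟨by positivity, ?_, (le_abs_self _).trans (hup hC₁0 (by linarith) hC₁ x)⟩
    rw [mul_div_assoc]
    exact (mul_le_mul_of_nonneg_left (div_le_lorentz hb x) hB0.le).trans (hB x)
  · rw [hit2]
    exact abs_le.1 (hup hC₂0 (by linarith) hC₂ x)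
  · rw [hit3]
    exact abs_le.1 (hup hC₃0 (by linarith) hC₃ x)
end
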